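/- Let M = (X, I) be a matroid with finite ground set X, and let S_1, …, S_ℓ be a set partition of X. Define J_1 := { c ∈ ℕ^ℓ : there exists an independent set A ∈ I with |A ∩ S_i| = c_i for all i ∈ [ℓ] }. Then J_1 is a discrete polymatroid; that is: (1) if c ∈ J_1 and d ∈ ℕ^ℓ satisfies d_i ≤ c_i for all i, then d ∈ J_1; and (2) if c, d ∈ J_1 with Σ_i c_i < Σ_i d_i, then there exists i ∈ [ℓ] with c_i < d_i such that c + e_i ∈ J_1, where e_i is the i-th standard unit vector. -/

import Mathlib

open Set

section Partition

variable {α ι : Type*} {S : ι → Set α}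

theorem ncard_eq_sum_ncard_inter [Finite α] [Fintype ι] (hdisj : ∀ i j, i ≠ j → Disjoint (S i) (S j))
    {A : Set α} (hA : A ⊆ ⋃ i, S i) : A.ncard = ∑ i, (A ∩ S i).ncard := by
  have hU : A = ⋃ i, A ∩ S i := by rw [← inter_iUnion, inter_eq_left.2 hA]
  conv_lhs => rw [hU]
  rw [ncard_iUnion_of_finite (fun i => toFinite _), finsum_eq_sum_of_fintype]
  exact fun i j hij => (hdisj i j hij).mono inter_subset_right inter_subset_right

theorem ncard_insert_inter [Finite α] [DecidableEq ι] (hdisj : ∀ i j, i ≠ j → Disjoint (S i) (S j))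
    {A : Set α} {e : α} {i : ι} (he : e ∉ A) (hei : e ∈ S i) (j : ι) :
    (insert e A ∩ S j).ncard = (A ∩ S j).ncard + if j = i then 1 else 0 := by
  split_ifs with h
  · subst h
    rw [insert_inter_of_mem hei, ncard_insert_of_notMem (fun h => he h.1)]
  · rw [insert_inter_of_notMem (fun hej => (hdisj j i h).le_bot ⟨hej, hei⟩), add_zero]

theorem Matroid.Indep.exists_indep_ncard_inter_eq [Finite α] {M : Matroid α}
    (hdisj : ∀ i j, i ≠ j → Disjoint (S i) (S j)) {A : Set α} (hA : M.Indep A) {d : ι → ℕ}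
    (hd : ∀ i, d i ≤ (A ∩ S i).ncard) :
    ∃ B, M.Indep B ∧ ∀ i, (B ∩ S i).ncard = d i := by
  choose T hTA hT using fun i => exists_subset_card_eq (hd i)
  refine ⟨⋃ i, T i, hA.subset (iUnion_subset fun i => (hTA i).trans inter_subset_left),
    fun i => ?_⟩
  rw [← hT i]
  congr 1
  refine subset_antisymm ?_
    (subset_inter (subset_iUnion T i) ((hTA i).trans inter_subset_right))
  rintro x ⟨hx, hxi⟩
  obtain ⟨j, hj⟩ := mem_iUnion.1 hx
  obtain rfl : j = i := by
    by_contra hji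
    exact (hdisj j i hji).le_bot ⟨(hTA j hj).2, hxi⟩
  exact hj

theorem Matroid.Indep.exists_indep_ncard_inter_eq_add [Finite α] [Fintype ι] [DecidableEq ι]
    {M : Matroid α} (hdisj : ∀ i j, i ≠ j → Disjoint (S i) (S j)) (hcover : M.E ⊆ ⋃ i, S i)
    {A B : Set α} (hA : M.Indep A) (hB : M.Indep B)
    (hAB : ∑ i, (A ∩ S i).ncard < ∑ i, (B ∩ S i).ncard) :
    ∃ i, (A ∩ S i).ncard < (B ∩ S i).ncard ∧ ∃ C, M.Indep C ∧
      ∀ j, (C ∩ S j).ncard = (A ∩ S j).ncard + if j = i then 1 else 0 := by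
  induction hn : (B \ A).ncard using Nat.strong_induction_on generalizing A with
  | _ n ih =>
  have hlt : A.encard < B.encard := by
    rw [← (toFinite A).cast_ncard_eq, ← (toFinite B).cast_ncard_eq, Nat.cast_lt,
      ncard_eq_sum_ncard_inter hdisj (hA.subset_ground.trans hcover),
      ncard_eq_sum_ncard_inter hdisj (hB.subset_ground.trans hcover)]
    exact hAB
  obtain ⟨e, ⟨heB, heA⟩, hins⟩ := hA.augment hB hlt
  obtain ⟨i, hei⟩ := mem_iUnion.1 (hcover (hB.subset_ground heB))
  by_cases hi : (A ∩ S i).ncard < (B ∩ S i).ncard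
  · exact ⟨i, hi, insert e A, hins, ncard_insert_inter hdisj heA hei⟩
  obtain ⟨f, ⟨hfA, hfi⟩, hfB⟩ : ∃ f ∈ A ∩ S i, f ∉ B := by
    by_contra! h
    refine hi (ncard_lt_ncard ⟨fun x hx => ⟨h x hx, hx.2⟩, fun hsub => ?_⟩)
    exact heA (hsub ⟨heB, hei⟩).1
  have hprofile : ∀ j, ((insert e A \ {f}) ∩ S j).ncard = (A ∩ S j).ncard := fun j => by
    have h₁ := ncard_insert_inter hdisj heA hei j
    have h₂ := ncard_insert_inter hdisj (A := insert e A \ {f}) (e := f) (by simp) hfi j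
    rw [insert_sdiff_singleton, insert_eq_of_mem (mem_insert_of_mem e hfA), h₁] at h₂
    exact (Nat.add_right_cancel h₂).symm
  have hdecr : (B \ (insert e A \ {f})).ncard < n := by
    rw [← hn]
    refine ncard_lt_ncard ⟨fun x hx => ⟨hx.1, fun hxA => hx.2 ⟨mem_insert_of_mem e hxA, ?_⟩⟩,
      fun hsub => ?_⟩
    · rintro rfl
      exact hfB hx.1
    · refine (hsub ⟨heB, heA⟩).2 ⟨mem_insert e A, ?_⟩
      rintro rfl
      exact hfB heB
  simpa only [hprofile] using
    ih _ hdecr (hins.subset sdiff_subset) (by simpa only [hprofile] using hAB) rfl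

end Partition

/-- **`J₁` is a discrete polymatroid** (from the proof of Theorem 1.6). For a
set partition `S₁, …, S_ℓ` of the ground set of a matroid `M`, the set
`J₁ = { c ∈ ℕ^ℓ : ∃ independent A with |A ∩ S i| = c i for all i }` is closed
downward and satisfies the exchange property. -/
theorem J1_discrete_polymatroid {α : Type*} [Fintype α] (M : Matroid α) (ℓ : ℕ)
    (S : Fin ℓ → Set α)
    (hdisj : ∀ i j, i ≠ j → Disjoint (S i) (S j))
    (hcover : (⋃ i, S i) = M.E) :
    (∀ c d : Fin ℓ → ℕ,
      (∃ A : Set α, M.Indep A ∧ ∀ i, (A ∩ S i).ncard = c i) →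
      (∀ i, d i ≤ c i) →
      (∃ A : Set α, M.Indep A ∧ ∀ i, (A ∩ S i).ncard = d i)) ∧
    (∀ c d : Fin ℓ → ℕ,
      (∃ A : Set α, M.Indep A ∧ ∀ i, (A ∩ S i).ncard = c i) →
      (∃ A : Set α, M.Indep A ∧ ∀ i, (A ∩ S i).ncard = d i) →
      (∑ i, c i < ∑ i, d i) →
      ∃ i : Fin ℓ, c i < d i ∧
        (∃ A : Set α, M.Indep A ∧ ∀ j, (A ∩ S j).ncard = c j + (if j = i then 1 else 0))) := by
  refine ⟨?_, ?_⟩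
  · rintro c d ⟨A, hA, hc⟩ hdc
    exact hA.exists_indep_ncard_inter_eq hdisj fun i => (hdc i).trans (hc i).ge
  · rintro c d ⟨A, hA, hc⟩ ⟨B, hB, hd⟩ hlt
    simp only [← hc, ← hd] at hlt ⊢
    exact hA.exists_indep_ncard_inter_eq_add hdisj hcover.ge hB hlt
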